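/- Let u, w ∈ S_∞ and let p be a positive integer such that w(p) = u(p) and ℓ(w) − ℓ(u) = ℓ(w/_p) − ℓ(u/_p). Then the map y ↦ ε_{p,u(p)}(y) is an order isomorphism from the Bruhat interval [u/_p, w/_p] = {y : u/_p ≤ y ≤ w/_p} onto the Bruhat interval [u,w] = {v : u ≤ v ≤ w}. -/

import Mathlib

/-- A permutation of the positive integers belongs to `S_∞` when it moves only
finitely many points. -/
def FinSupp (w : Equiv.Perm ℕ+) : Prop := {x : ℕ+ | w x ≠ x}.Finite

/-- The length `ℓ(w)` of a permutation: its number of inversions. -/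
noncomputable def len (w : Equiv.Perm ℕ+) : ℕ :=
  Set.ncard {p : ℕ+ × ℕ+ | p.1 < p.2 ∧ w p.2 < w p.1}

/-- Covering relation of the Bruhat order: `u ⋖ u(a,b)` for `a < b` with
`ℓ(u(a,b)) = ℓ(u) + 1`. -/
def BruhatCov (u w : Equiv.Perm ℕ+) : Prop :=
  ∃ a b : ℕ+, a < b ∧ w = u * Equiv.swap a b ∧ len w = len u + 1

/-- The Bruhat order on `S_∞`. -/
def Bruhat : Equiv.Perm ℕ+ → Equiv.Perm ℕ+ → Prop :=
  Relation.ReflTransGen BruhatCov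

/-- `y = w/_p`, the permutation obtained by deleting row `p` and column `w p`
from the permutation matrix of `w`: setting `i' = i` for `i < p` and
`i' = i + 1` for `i ≥ p`, we have `y i = w i'` if `w i' < w p` and
`y i = w i' - 1` if `w i' > w p`.  (Note `ε_{p,q}(y)` is then the unique
permutation `v` with `v p = q` and `IsDel p v y`.) -/
def IsDel (p : ℕ+) (w y : Equiv.Perm ℕ+) : Prop :=
  ∀ i : ℕ+, y i = if w (if i < p then i else i + 1) < w p
      then w (if i < p then i else i + 1)
      else w (if i < p then i else i + 1) - 1

/-- The order embedding of the positive integers that skips the value `p`. -/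
def skip (p i : ℕ+) : ℕ+ := if i < p then i else i + 1

lemma skip_coe (p i : ℕ+) :
    ((skip p i : ℕ+) : ℕ) = if (i : ℕ) < p then (i : ℕ) else (i : ℕ) + 1 := by
  unfold skip
  simp only [← PNat.coe_lt_coe]
  split_ifs <;> simp

lemma skip_lt_skip {p i j : ℕ+} : skip p i < skip p j ↔ i < j := by
  rw [← PNat.coe_lt_coe, ← PNat.coe_lt_coe, skip_coe, skip_coe]
  split_ifs <;> omega

lemma skip_injective (p : ℕ+) : Function.Injective (skip p) := by
  have h : StrictMono (skip p) := fun _ _ hij => skip_lt_skip.2 hij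
  exact h.injective

lemma skip_ne (p i : ℕ+) : skip p i ≠ p := by
  intro h
  have h2 := skip_coe p i
  rw [h] at h2
  split_ifs at h2 <;> omega

lemma exists_skip_eq {p i : ℕ+} (h : i ≠ p) : ∃ j, skip p j = i := by
  rcases lt_or_gt_of_ne h with h | h
  · exact ⟨i, if_pos h⟩
  · have h1 : (1 : ℕ+) < i := lt_of_le_of_lt one_le h
    refine ⟨i - 1, PNat.eq ?_⟩
    have hsub := PNat.sub_coe i 1
    rw [if_pos h1, PNat.one_coe] at hsub
    rw [← PNat.coe_lt_coe] at h h1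
    rw [PNat.one_coe] at h1
    rw [skip_coe, hsub]
    split_ifs <;> omega

lemma isDel_iff {p : ℕ+} {v y : Equiv.Perm ℕ+} :
    IsDel p v y ↔ ∀ i, skip (v p) (y i) = v (skip p i) := by
  refine forall_congr' fun i => ?_
  have hne : v (skip p i) ≠ v p := fun h => skip_ne p i (v.injective h)
  change y i = (if v (skip p i) < v p then v (skip p i) else v (skip p i) - 1) ↔ _
  obtain ⟨j, hj⟩ := exists_skip_eq hne
  rw [← hj, (skip_injective (v p)).eq_iff]
  suffices h : (if skip (v p) j < v p then skip (v p) j else skip (v p) j - 1) = j by rw [h]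
  by_cases h : j < v p
  · simp [skip, h]
  · have h2 : ¬ j + 1 < v p := fun h3 => h (lt_trans (PNat.lt_add_right j 1) h3)
    simp [skip, h, h2]

lemma IsDel.unique {p : ℕ+} {v y z : Equiv.Perm ℕ+} (hy : IsDel p v y) (hz : IsDel p v z) :
    y = z :=
  Equiv.ext fun i => (hy i).trans (hz i).symm

lemma IsDel.unique_lift {p : ℕ+} {v w y : Equiv.Perm ℕ+} (hv : IsDel p v y) (hw : IsDel p w y)
    (h : v p = w p) : v = w := by
  rw [isDel_iff] at hv hw
  ext1 i
  by_cases hi : i = p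
  · rw [hi, h]
  · obtain ⟨j, rfl⟩ := exists_skip_eq hi
    rw [← hv, ← hw, h]

lemma mul_swap_skip_apply (p a b : ℕ+) (v : Equiv.Perm ℕ+) :
    (v * Equiv.swap (skip p a) (skip p b)) p = v p := by
  rw [Equiv.Perm.mul_apply,
    Equiv.swap_apply_of_ne_of_ne (skip_ne p a).symm (skip_ne p b).symm]

lemma IsDel.mul_swap {p : ℕ+} {v y : Equiv.Perm ℕ+} (h : IsDel p v y) (a b : ℕ+) :
    IsDel p (v * Equiv.swap (skip p a) (skip p b)) (y * Equiv.swap a b) := by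
  rw [isDel_iff] at h ⊢
  intro i
  rw [mul_swap_skip_apply, Equiv.Perm.mul_apply, Equiv.Perm.mul_apply, h,
    (skip_injective p).map_swap]

lemma FinSupp.mul_swap {w : Equiv.Perm ℕ+} (h : FinSupp w) (a b : ℕ+) :
    FinSupp (w * Equiv.swap a b) := by
  refine (h.union (Set.toFinite {a, b})).subset fun x hx => ?_
  by_contra hc
  simp only [Set.mem_union, Set.mem_ofPred_eq, Set.mem_insert_iff, Set.mem_singleton_iff,
    not_or] at hc
  apply hx
  rw [Equiv.Perm.mul_apply, Equiv.swap_apply_of_ne_of_ne hc.2.1 hc.2.2]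
  exact not_not.1 hc.1

/-- The set of inversions of a permutation. -/
def inv (w : Equiv.Perm ℕ+) : Set (ℕ+ × ℕ+) := {x | x.1 < x.2 ∧ w x.2 < w x.1}

lemma FinSupp.finite_inv {w : Equiv.Perm ℕ+} (h : FinSupp w) : (inv w).Finite := by
  obtain ⟨N, hN⟩ := h.bddAbove
  have hfix : ∀ x, N < x → w x = x := fun x hx => by
    by_contra hc
    exact absurd (hN hc) (not_le.2 hx)
  refine ((Set.finite_Icc 1 N).prod (Set.finite_Icc 1 N)).subset ?_
  rintro ⟨i, j⟩ ⟨hij, hw⟩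
  have hij : i < j := hij
  have hw : w j < w i := hw
  have hj : j ≤ N := by
    by_contra! hc
    rw [hfix j hc] at hw
    have := w.injective (hfix (w i) (hc.trans hw))
    rw [this] at hw
    exact lt_asymm hij hw
  exact ⟨⟨one_le, hij.le.trans hj⟩, one_le, hj⟩

lemma len_lt_len_mul_swap {u : Equiv.Perm ℕ+} {a b : ℕ+} (hfin : (inv (u * Equiv.swap a b)).Finite)
    (hab : a < b) (h : u a < u b) : len u < len (u * Equiv.swap a b) := by
  set s := Equiv.swap a b with hs
  let f : ℕ+ × ℕ+ → ℕ+ × ℕ+ := fun x => if s x.1 < s x.2 then (s x.1, s x.2) else x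
  have hss : ∀ x, s (s x) = x := fun x => by simp [hs]
  have hinj : Set.InjOn f (inv u) := by
    rintro ⟨i, j⟩ ⟨hij, -⟩ ⟨k, l⟩ ⟨hkl, -⟩ heq
    simp only [f] at heq hij hkl
    split_ifs at heq with h1 h2 h2
    · simpa using heq
    · simp only [Prod.mk.injEq] at heq
      rw [← heq.1, ← heq.2, hss, hss] at h2
      exact absurd hij h2
    · simp only [Prod.mk.injEq] at heq
      rw [heq.1, heq.2, hss, hss] at h1
      exact absurd hkl h1
    · exact heq
  have hlt : f '' inv u ⊂ inv (u * s) := by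
    rw [Set.ssubset_iff_of_subset]
    · refine ⟨(a, b), ⟨hab, by simpa [hs] using h⟩, ?_⟩
      rintro ⟨⟨i, j⟩, ⟨hij, hu⟩, heq⟩
      simp only [f] at heq hij hu
      split_ifs at heq with h1 <;> simp only [Prod.mk.injEq] at heq
      · have hi := congrArg s heq.1
        have hj := congrArg s heq.2
        rw [hss] at hi hj
        rw [hi, hj, hs] at hij
        simp only [Equiv.swap_apply_left, Equiv.swap_apply_right] at hij
        exact lt_asymm hab hij
      · rw [heq.1, heq.2] at hu
        exact lt_asymm h hu
    · rintro _ ⟨⟨i, j⟩, ⟨hij, hu⟩, rfl⟩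
      simp only [f] at hij hu ⊢
      split_ifs with h1
      · exact ⟨h1, by simpa [hss] using hu⟩
      · refine ⟨hij, ?_⟩
        simp only [Equiv.Perm.mul_apply]
        simp only [hs, Equiv.swap_apply_def] at h1 ⊢
        grind
  calc len u = (f '' inv u).ncard := hinj.ncard_image.symm
    _ < len (u * s) := Set.ncard_lt_ncard hlt hfin

lemma BruhatCov.exists_swap {u v : Equiv.Perm ℕ+} (hu : (inv u).Finite) (h : BruhatCov u v) :
    ∃ a b, a < b ∧ u a < u b ∧ v = u * Equiv.swap a b ∧ len v = len u + 1 := by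
  obtain ⟨a, b, hab, rfl, hl⟩ := h
  refine ⟨a, b, hab, ?_, rfl, hl⟩
  by_contra hc
  have hba : u b < u a := lt_of_le_of_ne (not_lt.1 hc) fun h => hab.ne (u.injective h).symm
  have := @len_lt_len_mul_swap (u * Equiv.swap a b) a b (by rwa [Equiv.mul_swap_mul_self]) hab
    (by simpa using hba)
  rw [Equiv.mul_swap_mul_self] at this
  omega

lemma BruhatCov.finSupp {u v : Equiv.Perm ℕ+} (hu : FinSupp u) (h : BruhatCov u v) :
    FinSupp v := by
  obtain ⟨a, b, -, rfl, -⟩ := h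
  exact hu.mul_swap a b

lemma Bruhat.finSupp {u v : Equiv.Perm ℕ+} (hu : FinSupp u) (h : Bruhat u v) : FinSupp v := by
  induction h with
  | refl => exact hu
  | tail _ h ih => exact h.finSupp ih

/-- The number of positions `i < p` at which the value of `w` is greater than `q`. -/
def rk (p : ℕ+) (q : ℕ) (w : Equiv.Perm ℕ+) : ℕ := {i ∈ Finset.Ico 1 p | q < (w i : ℕ)}.card

lemma rk_le_rk_mul_swap (p : ℕ+) (q : ℕ) {u : Equiv.Perm ℕ+} {a b : ℕ+} (hab : a < b)
    (h : u a < u b) : rk p q u ≤ rk p q (u * Equiv.swap a b) := by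
  rw [← PNat.coe_lt_coe] at h
  unfold rk
  by_cases hb : b < p
  · refine Finset.card_le_card_of_injOn (Equiv.swap a b) ?_ (Equiv.injective _).injOn
    intro i hi
    rw [Finset.mem_coe, Finset.mem_filter, Finset.mem_Ico] at hi ⊢
    rw [Equiv.Perm.mul_apply, Equiv.swap_apply_self]
    refine ⟨⟨one_le, ?_⟩, hi.2⟩
    have := hab.trans hb
    rw [Equiv.swap_apply_def]
    split_ifs <;> simp_all
  · refine Finset.card_le_card fun i hi => ?_
    rw [Finset.mem_filter, Finset.mem_Ico] at hi ⊢
    refine ⟨hi.1, ?_⟩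
    rw [Equiv.Perm.mul_apply]
    have hib : i ≠ b := by rintro rfl; exact hb hi.1.2
    rw [Equiv.swap_apply_def, if_neg hib]
    split_ifs with hia
    · rw [hia] at hi
      exact hi.2.trans h
    · exact hi.2

lemma Bruhat.rk_le {u v : Equiv.Perm ℕ+} (hu : FinSupp u) (h : Bruhat u v) (p : ℕ+) (q : ℕ) :
    rk p q u ≤ rk p q v := by
  induction h with
  | refl => exact le_rfl
  | tail h1 h2 ih =>
    obtain ⟨a, b, hab, hlt, rfl, -⟩ := h2.exists_swap (Bruhat.finSupp hu h1).finite_inv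
    exact ih.trans (rk_le_rk_mul_swap p q hab hlt)

lemma rk_add_one (p : ℕ+) (q : ℕ) (w : Equiv.Perm ℕ+) :
    rk (p + 1) q w = rk p q w + if q < (w p : ℕ) then 1 else 0 := by
  have h : Finset.Ico 1 (p + 1) = insert p (Finset.Ico 1 p) := by
    ext i
    simp only [Finset.mem_Ico, one_le, true_and, Finset.mem_insert, PNat.lt_add_one_iff]
    exact le_iff_eq_or_lt
  unfold rk
  rw [h, Finset.filter_insert]
  split_ifs
  · rw [Finset.card_insert_of_notMem (by simp)]
  · simp

lemma rk_pred (p : ℕ+) (w : Equiv.Perm ℕ+) : rk p ((w p : ℕ) - 1) w = rk p (w p) w := by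
  unfold rk
  congr 1
  refine Finset.filter_congr fun i hi => ?_
  have hne : (w i : ℕ) ≠ w p := fun h =>
    (Finset.mem_Ico.1 hi).2.ne (w.injective (PNat.eq h))
  have := (w p).pos
  omega

/-- In a Bruhat interval whose ends agree at `p` and have the same number of inversions
`(i, p)`, every permutation takes the same value at `p`. -/
lemma Bruhat.apply_eq {u v w : Equiv.Perm ℕ+} (hu : FinSupp u) (h1 : Bruhat u v)
    (h2 : Bruhat v w) {p : ℕ+} (hp : w p = u p) (hA : rk p (w p) w = rk p (u p) u) :
    v p = u p := by
  have hv := Bruhat.finSupp hu h1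
  have key : ∀ r q, rk r q u = rk r q w → rk r q v = rk r q u := fun r q h =>
    le_antisymm ((Bruhat.rk_le hv h2 r q).trans h.ge) (Bruhat.rk_le hu h1 r q)
  have e1 := rk_pred p u
  have e2 := rk_pred p w
  rw [hp] at hA e2
  have k1 := key p (u p) hA.symm
  have k2 := key p ((u p : ℕ) - 1) (by omega)
  have k3 := key (p + 1) (u p) (by rw [rk_add_one, rk_add_one, hp, hA])
  have k4 := key (p + 1) ((u p : ℕ) - 1) (by rw [rk_add_one, rk_add_one, hp, e1, e2, hA])
  rw [rk_add_one, rk_add_one, k1] at k3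
  rw [rk_add_one, rk_add_one, k2] at k4
  have := (u p).pos
  apply PNat.eq
  split_ifs at k3 k4 <;> omega

lemma IsDel.len_add {p : ℕ+} {v y : Equiv.Perm ℕ+} (hv : (inv v).Finite) (h : IsDel p v y) :
    len v + p = len y + 2 * rk p (v p) v + v p := by
  rw [isDel_iff] at h
  have hy : ∀ i j, y i < y j ↔ v (skip p i) < v (skip p j) := fun i j => by
    rw [← h, ← h, skip_lt_skip]
  let L : Finset ℕ+ := {i ∈ Finset.Ico 1 p | (v p : ℕ) < (v i : ℕ)}
  let R : Finset ℕ+ := {k ∈ Finset.Ico 1 (v p) | p < v.symm k}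
  let X : Set (ℕ+ × ℕ+) := Prod.map (skip p) (skip p) '' inv y
  let Y : Set (ℕ+ × ℕ+) := (fun i => (i, p)) '' (L : Set ℕ+)
  let Z : Set (ℕ+ × ℕ+) := (fun k => (p, v.symm k)) '' (R : Set ℕ+)
  have hinv : inv v = X ∪ (Y ∪ Z) := by
    ext ⟨i, j⟩
    constructor
    · rintro ⟨hij, hw⟩
      simp only at hij hw
      by_cases hi : i = p
      · subst hi
        exact Or.inr (Or.inr ⟨v j, by simpa [R] using ⟨hw, hij⟩, by simp⟩)
      · by_cases hj : j = p
        · subst hj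
          exact Or.inr (Or.inl ⟨i, by simpa [L] using ⟨hij, hw⟩, rfl⟩)
        · obtain ⟨i, rfl⟩ := exists_skip_eq hi
          obtain ⟨j, rfl⟩ := exists_skip_eq hj
          exact Or.inl ⟨(i, j), ⟨skip_lt_skip.1 hij, (hy j i).2 hw⟩, rfl⟩
    · rintro (⟨⟨i, j⟩, ⟨hij, hw⟩, heq⟩ | ⟨i, hi, heq⟩ | ⟨k, hk, heq⟩) <;>
        simp only [Prod.map, Prod.mk.injEq] at heq <;> obtain ⟨rfl, rfl⟩ := heq
      · exact ⟨skip_lt_skip.2 hij, (hy j i).1 hw⟩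
      · simpa [inv, L] using hi
      · have : k < v p ∧ p < v.symm k := by simpa [R] using hk
        exact ⟨this.2, by simpa using this.1⟩
  have hX : X.ncard = len y :=
    Set.ncard_image_of_injective _ ((skip_injective p).prodMap (skip_injective p))
  have hY : Y.ncard = L.card :=
    (Set.ncard_image_of_injective _ (Prod.mk_left_injective p)).trans (Set.ncard_coe_finset L)
  have hZ : Z.ncard = R.card :=
    (Set.ncard_image_of_injective _ ((Prod.mk_right_injective p).comp v.symm.injective)).trans
      (Set.ncard_coe_finset R)
  have hYZ : Disjoint Y Z := by
    rw [Set.disjoint_left]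
    rintro _ ⟨i, hi, rfl⟩ ⟨k, hk, heq⟩
    simp only [Prod.mk.injEq] at heq
    have : i < p := by
      simp only [L, Finset.coe_filter, Finset.mem_Ico, Set.mem_ofPred_eq] at hi
      exact hi.1.2
    exact this.ne heq.1.symm
  have hXYZ : Disjoint X (Y ∪ Z) := by
    rw [Set.disjoint_left]
    rintro _ ⟨⟨i, j⟩, -, rfl⟩ (⟨k, -, heq⟩ | ⟨k, -, heq⟩) <;>
      simp only [Prod.map, Prod.mk.injEq] at heq
    · exact skip_ne p j heq.2.symm
    · exact skip_ne p i heq.1.symm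
  have hfY : Y.Finite := L.finite_toSet.image _
  have hfZ : Z.Finite := R.finite_toSet.image _
  have hfX : X.Finite := hv.subset (by rw [hinv]; exact Set.subset_union_left)
  have hlen : len v = len y + (L.card + R.card) := by
    change (inv v).ncard = _
    rw [hinv, Set.ncard_union_eq hXYZ hfX (hfY.union hfZ), Set.ncard_union_eq hYZ hfY hfZ,
      hX, hY, hZ]
  have hL : L.card + {i ∈ Finset.Ico 1 p | ¬ (v p : ℕ) < (v i : ℕ)}.card = p - 1 := by
    rw [Finset.card_filter_add_card_filter_not, PNat.card_Ico, PNat.one_coe]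
  have hR : R.card + {k ∈ Finset.Ico 1 (v p) | ¬ p < v.symm k}.card = v p - 1 := by
    rw [Finset.card_filter_add_card_filter_not, PNat.card_Ico, PNat.one_coe]
  have hLR : {i ∈ Finset.Ico 1 p | ¬ (v p : ℕ) < (v i : ℕ)}.card =
      {k ∈ Finset.Ico 1 (v p) | ¬ p < v.symm k}.card := by
    refine Finset.card_equiv v fun i => ?_
    simp only [Finset.mem_filter, Finset.mem_Ico, one_le, true_and, PNat.coe_lt_coe, not_lt,
      Equiv.symm_apply_apply]
    constructor
    · exact fun ⟨h1, h2⟩ => ⟨lt_of_le_of_ne h2 fun h => h1.ne (v.injective h), h1.le⟩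
    · rintro ⟨h1, h2⟩
      exact ⟨lt_of_le_of_ne h2 (by rintro rfl; exact h1.ne rfl), h1.le⟩
  have hrk : rk p (v p) v = L.card := rfl
  have := p.pos
  have := (v p).pos
  omega

lemma IsDel.finite_inv {p : ℕ+} {v y : Equiv.Perm ℕ+} (hv : (inv v).Finite) (h : IsDel p v y) :
    (inv y).Finite := by
  rw [isDel_iff] at h
  refine Set.Finite.of_finite_image (f := Prod.map (skip p) (skip p)) (hv.subset ?_)
    ((skip_injective p).prodMap (skip_injective p)).injOn
  rintro _ ⟨⟨i, j⟩, ⟨hij, hw⟩, rfl⟩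
  refine ⟨skip_lt_skip.2 hij, ?_⟩
  simp only [Prod.map]
  rw [← h, ← h]
  exact skip_lt_skip.2 hw

/-- A chain of covers below the deletion lifts, and the lift is again a chain of covers
as soon as the number of inversions `(i, p)` is the same at both ends. -/
lemma Bruhat.exists_lift {p : ℕ+} {u u' y : Equiv.Perm ℕ+} (hu : FinSupp u) (hd : IsDel p u u')
    (h : Bruhat u' y) : ∃ v, FinSupp v ∧ IsDel p v y ∧ v p = u p ∧
      rk p (u p) u ≤ rk p (u p) v ∧ (rk p (u p) v = rk p (u p) u → Bruhat u v) := by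
  induction h with
  | refl => exact ⟨u, hu, hd, rfl, le_rfl, fun _ => Relation.ReflTransGen.refl⟩
  | tail _ hcov ih =>
    obtain ⟨v, hv, hdv, hvp, hle, hB⟩ := ih
    obtain ⟨a, b, hab, hlt, rfl, hl⟩ := hcov.exists_swap (hdv.finite_inv hv.finite_inv)
    have hvlt : v (skip p a) < v (skip p b) := by
      rw [← isDel_iff.1 hdv, ← isDel_iff.1 hdv]
      exact skip_lt_skip.2 hlt
    have hab' : skip p a < skip p b := skip_lt_skip.2 hab
    have hrk := rk_le_rk_mul_swap p (u p) hab' hvlt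
    have hp := mul_swap_skip_apply p a b v
    have hd' := hdv.mul_swap a b
    have hf' := hv.mul_swap (skip p a) (skip p b)
    refine ⟨_, hf', hd', hp.trans hvp, hle.trans hrk, fun heq => (hB (by omega)).tail ?_⟩
    refine ⟨_, _, hab', rfl, ?_⟩
    have l1 := hdv.len_add hv.finite_inv
    have l2 := hd'.len_add hf'.finite_inv
    rw [hp, hvp] at l2
    rw [hvp] at l1
    omega

/-- A chain of covers along which the value at `p` and the number of inversions `(i, p)` do not
change stays a chain of covers after deletion. -/
lemma Bruhat.exists_isDel {p : ℕ+} {u w v₁ v₂ y₁ : Equiv.Perm ℕ+} (hu : FinSupp u)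
    (hp : w p = u p) (hA : rk p (w p) w = rk p (u p) u) (h1 : Bruhat u v₁) (h : Bruhat v₁ v₂)
    (h2 : Bruhat v₂ w) (hd : IsDel p v₁ y₁) : ∃ y₂, IsDel p v₂ y₂ ∧ Bruhat y₁ y₂ := by
  induction h with
  | refl => exact ⟨y₁, hd, Relation.ReflTransGen.refl⟩
  | @tail v v' hv hcov ih =>
    have hB : Bruhat u v := Relation.ReflTransGen.trans h1 hv
    have hvw : Bruhat v w := Relation.ReflTransGen.head hcov h2
    obtain ⟨y, hdy, hy⟩ := ih hvw
    have hB' : Bruhat u v' := Relation.ReflTransGen.tail hB hcov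
    have e := hB.apply_eq hu hvw hp hA
    have e' := hB'.apply_eq hu h2 hp hA
    have hfv := hB.finSupp hu
    have hfv' := hB'.finSupp hu
    have r1 := hB.rk_le hu p (u p)
    have r2 := Bruhat.rk_le hfv (Relation.ReflTransGen.single hcov) p (u p)
    have r3 := Bruhat.rk_le hfv' h2 p (u p)
    rw [hp] at hA
    obtain ⟨a, b, hab, rfl, hl⟩ := hcov
    have hne : ∀ c, c = Equiv.swap a b p → c = p := fun c hc => by
      rw [hc]
      exact v.injective (e'.trans e.symm)
    have ha : a ≠ p := by
      rintro rfl
      exact hab.ne' (hne b (Equiv.swap_apply_left _ _).symm)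
    have hb : b ≠ p := by
      rintro rfl
      exact hab.ne (hne a (Equiv.swap_apply_right _ _).symm)
    obtain ⟨a, rfl⟩ := exists_skip_eq ha
    obtain ⟨b, rfl⟩ := exists_skip_eq hb
    have hd' := hdy.mul_swap a b
    refine ⟨_, hd', hy.tail ⟨a, b, skip_lt_skip.1 hab, rfl, ?_⟩⟩
    have l1 := hdy.len_add hfv.finite_inv
    have l2 := hd'.len_add hfv'.finite_inv
    rw [e] at l1
    rw [e'] at l2
    omega

/-- Suppose `w p = u p` and `ℓ(w) - ℓ(u) = ℓ(w/_p) - ℓ(u/_p)`.  Then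
`y ↦ ε_{p, u p}(y)` is an order isomorphism from the Bruhat interval
`[u/_p, w/_p]` onto the Bruhat interval `[u, w]`: every `y` in the first
interval lifts to a (unique) `v = ε_{p, u p}(y)` lying in `[u,w]`, every `v` in
`[u,w]` arises this way, and the correspondence preserves and reflects the
Bruhat order. -/
theorem stmt_18 (u w : Equiv.Perm ℕ+) (hu : FinSupp u) (hw : FinSupp w) (p : ℕ+)
    (hp : w p = u p) (u' w' : Equiv.Perm ℕ+) (hu' : IsDel p u u') (hw' : IsDel p w w')
    (hlen : (len w : ℤ) - (len u : ℤ) = (len w' : ℤ) - (len u' : ℤ)) :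
    (∀ y : Equiv.Perm ℕ+, Bruhat u' y → Bruhat y w' →
        ∃ v : Equiv.Perm ℕ+, IsDel p v y ∧ v p = u p ∧ Bruhat u v ∧ Bruhat v w) ∧
    (∀ v : Equiv.Perm ℕ+, Bruhat u v → Bruhat v w →
        ∃ y : Equiv.Perm ℕ+, IsDel p v y ∧ v p = u p ∧ Bruhat u' y ∧ Bruhat y w') ∧
    (∀ y₁ y₂ v₁ v₂ : Equiv.Perm ℕ+,
        Bruhat u' y₁ → Bruhat y₁ w' → Bruhat u' y₂ → Bruhat y₂ w' →
        IsDel p v₁ y₁ → v₁ p = u p → IsDel p v₂ y₂ → v₂ p = u p →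
        (Bruhat y₁ y₂ ↔ Bruhat v₁ v₂)) := by
  have hA : rk p (w p) w = rk p (u p) u := by
    have l1 := hu'.len_add hu.finite_inv
    have l2 := hw'.len_add hw.finite_inv
    rw [hp] at l2 ⊢
    omega
  have hA' : rk p (u p) w = rk p (u p) u := by rw [← hA, hp]
  have lift : ∀ y₁ y₂ v₁ v₂ : Equiv.Perm ℕ+, Bruhat u' y₁ → Bruhat y₁ y₂ → Bruhat y₂ w' →
      IsDel p v₁ y₁ → v₁ p = u p → IsDel p v₂ y₂ → v₂ p = u p →
      Bruhat u v₁ ∧ Bruhat v₁ v₂ ∧ Bruhat v₂ w := by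
    intro y₁ y₂ v₁ v₂ h1 h12 h2 d1 e1 d2 e2
    obtain ⟨x₁, f1, c1, g1, r1, b1⟩ := h1.exists_lift hu hu'
    obtain rfl := c1.unique_lift d1 (g1.trans e1.symm)
    obtain ⟨x₂, f2, c2, g2, r2, b2⟩ := h12.exists_lift f1 c1
    obtain rfl := c2.unique_lift d2 (g2.trans (e1.trans e2.symm))
    obtain ⟨x₃, f3, c3, g3, r3, b3⟩ := h2.exists_lift f2 c2
    obtain rfl := c3.unique_lift hw' (g3.trans (e2.trans hp.symm))
    rw [e1] at r2 b2
    rw [e2] at r3 b3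
    exact ⟨b1 (by omega), b2 (by omega), b3 (by omega)⟩
  have refl : ∀ y, Bruhat y y := fun _ => Relation.ReflTransGen.refl
  refine ⟨fun y h1 h2 => ?_, fun v h1 h2 => ?_, ?_⟩
  · obtain ⟨v, -, d, e, -, -⟩ := h1.exists_lift hu hu'
    obtain ⟨b1, -, b2⟩ := lift y y v v h1 (refl y) h2 d e d e
    exact ⟨v, d, e, b1, b2⟩
  · obtain ⟨y, d, b⟩ := Bruhat.exists_isDel hu hp hA (refl u) h1 h2 hu'
    obtain ⟨z, d', b'⟩ := Bruhat.exists_isDel hu hp hA h1 h2 (refl w) d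
    obtain rfl := d'.unique hw'
    exact ⟨y, d, h1.apply_eq hu h2 hp hA, b, b'⟩
  · intro y₁ y₂ v₁ v₂ h1 h1' h2 h2' d1 e1 d2 e2
    refine ⟨fun h => (lift y₁ y₂ v₁ v₂ h1 h h2' d1 e1 d2 e2).2.1, fun h => ?_⟩
    obtain ⟨b1, -, -⟩ := lift y₁ y₁ v₁ v₁ h1 (refl _) h1' d1 e1 d1 e1
    obtain ⟨-, -, b2⟩ := lift y₂ y₂ v₂ v₂ h2 (refl _) h2' d2 e2 d2 e2
    obtain ⟨z, d, b⟩ := Bruhat.exists_isDel hu hp hA b1 h b2 d1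
    obtain rfl := d.unique d2
    exact b
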